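/- With M, X, e, f, C, A, M', C', A' and ω as in the setup, A has no submatrix of any of the following forms, where x, y, z are distinct non-zero elements of GF(4): [[x,x,0],[x,0,x]]; [[x,x,0],[x,0,y]]; [[x,x,0],[y,0,y]]; [[x,y,0],[x,0,y]]; [[x,0,0],[0,y,z]]; [[x,0,0],[0,x,0],[0,0,x]]; [[x,0,0],[0,x,0],[0,0,y]]; [[x,0,0],[0,y,0],[0,0,z]]. -/

import Mathlib

open Matroid Set
open scoped Classical

namespace Relax

variable {α β : Type*}

/-- A circuit of a matroid: a minimal dependent set. -/
def Circuit (M : Matroid α) (C : Set α) : Prop :=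
  M.Dep C ∧ ∀ D ⊂ C, M.Indep D

/-- A hyperplane of a matroid: a maximal proper flat. -/
def Hyperplane (M : Matroid α) (H : Set α) : Prop :=
  M.IsFlat H ∧ H ≠ M.E ∧ ∀ F, M.IsFlat F → H ⊂ F → F = M.E

/-- `X` is a circuit-hyperplane of `M`. -/
def CircuitHyperplane (M : Matroid α) (X : Set α) : Prop :=
  Circuit M X ∧ Hyperplane M X

/-- `M'` is obtained from `M` by relaxing the circuit-hyperplane `X` : the ground set is
unchanged and the bases of `M'` are exactly the bases of `M` together with `X`. -/
def IsRelaxation (M M' : Matroid α) (X : Set α) : Prop :=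
  CircuitHyperplane M X ∧ M'.E = M.E ∧ ∀ B, (M'.IsBase B ↔ M.IsBase B ∨ B = X)

/-- A matroid is representable over a field `F` if there is an assignment of vectors to its
elements under which independence coincides with linear independence. -/
def Representable (M : Matroid α) (F : Type*) [Field F] : Prop :=
  ∃ (n : ℕ) (φ : α → (Fin n → F)), ∀ I ⊆ M.E,
    (M.Indep I ↔ LinearIndependent F (fun x : I => φ (x : α)))

/-- The field GF(4). -/
abbrev GF4 := GaloisField 2 2

/-- The rank of a set in a matroid: the maximum size of an independent subset. -/
noncomputable def rk (M : Matroid α) (X : Set α) : ℕ :=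
  sSup {n | ∃ I, M.Indep I ∧ I ⊆ X ∧ I.ncard = n}

/-- Deletion of a set of elements. -/
def delete (M : Matroid α) (D : Set α) : Matroid α := M ↾ (M.E \ D)

/-- Contraction of a set of elements. -/
def contract (M : Matroid α) (C : Set α) : Matroid α := (delete M✶ C)✶

/-- `N` is a minor of `M`. -/
def MinorOf (N M : Matroid α) : Prop :=
  ∃ C D, C ⊆ M.E ∧ D ⊆ M.E ∧ Disjoint C D ∧ N = delete (contract M C) D

/-- Isomorphism of matroids. -/
def Iso (M : Matroid α) (N : Matroid β) : Prop :=
  ∃ e : M.E ≃ N.E, ∀ I : Set M.E,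
    M.Indep ((↑) '' I) ↔ N.Indep ((↑) '' (e '' I))

/-- `M` has a minor isomorphic to `N`. -/
def HasMinorIso (M : Matroid α) (N : Matroid β) : Prop :=
  ∃ M₀ : Matroid α, MinorOf M₀ M ∧ Iso M₀ N

/-- `M` has a minor isomorphic to a member of the set `𝒩` of matroids. -/
def HasMinorIn (M : Matroid α) (𝒩 : Set (Matroid β)) : Prop :=
  ∃ N ∈ 𝒩, HasMinorIso M N

/-- `M` is `𝒩`-fragile. -/
def Fragile (M : Matroid α) (𝒩 : Set (Matroid β)) : Prop :=
  HasMinorIn M 𝒩 ∧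
    ∀ a ∈ M.E, ¬ (HasMinorIn (delete M {a}) 𝒩 ∧ HasMinorIn (contract M {a}) 𝒩)

/-- `M` is (isomorphic to) the uniform matroid `U_{r,n}`. -/
def IsUniform (M : Matroid α) (r n : ℕ) : Prop :=
  M.E.Finite ∧ M.E.ncard = n ∧ ∀ I ⊆ M.E, (M.Indep I ↔ I.ncard ≤ r)

/-- `M` has a minor isomorphic to `U_{r,n}`. -/
def HasUnifMinor (M : Matroid α) (r n : ℕ) : Prop :=
  ∃ M₀, MinorOf M₀ M ∧ IsUniform M₀ r n

/-- `M` has a `{U_{2,5}, U_{3,5}}`-minor. -/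
def HasU25U35Minor (M : Matroid α) : Prop :=
  HasUnifMinor M 2 5 ∨ HasUnifMinor M 3 5

/-- `M` is `U_{2,4}`-fragile. -/
def FragileU24 (M : Matroid α) : Prop :=
  HasUnifMinor M 2 4 ∧
    ∀ a ∈ M.E, ¬ (HasUnifMinor (delete M {a}) 2 4 ∧ HasUnifMinor (contract M {a}) 2 4)

/-- `M` is `{U_{2,5}, U_{3,5}}`-fragile. -/
def FragileU25U35 (M : Matroid α) : Prop :=
  HasU25U35Minor M ∧
    ∀ a ∈ M.E, ¬ (HasU25U35Minor (delete M {a}) ∧ HasU25U35Minor (contract M {a}))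

/-- A loop. -/
def Loop (M : Matroid α) (x : α) : Prop := x ∈ M.E ∧ ¬ M.Indep {x}

/-- Two distinct non-loop elements are parallel if they form a two-element circuit. -/
def Parallel (M : Matroid α) (x y : α) : Prop := x ≠ y ∧ Circuit M {x, y}

/-- A parallel class: a maximal set of pairwise-parallel non-loop elements. -/
def ParallelClass (M : Matroid α) (A : Set α) : Prop :=
  A ⊆ M.E ∧ (∀ x ∈ A, ¬ Loop M x) ∧
    (∀ x ∈ A, ∀ y ∈ A, x ≠ y → Parallel M x y) ∧
    (∀ B, A ⊆ B → B ⊆ M.E → (∀ x ∈ B, ¬ Loop M x) →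
      (∀ x ∈ B, ∀ y ∈ B, x ≠ y → Parallel M x y) → B = A)

/-- A series class: a parallel class of the dual. -/
def SeriesClass (M : Matroid α) (A : Set α) : Prop := ParallelClass M✶ A

/-- A matroid is connected if every two distinct elements lie in a common circuit. -/
def Connected (M : Matroid α) : Prop :=
  ∀ x ∈ M.E, ∀ y ∈ M.E, x ≠ y → ∃ C, Circuit M C ∧ x ∈ C ∧ y ∈ C

/-- A `k`-separation of `M`. -/
def Separation (M : Matroid α) (k : ℕ) (A B : Set α) : Prop :=
  A ∪ B = M.E ∧ Disjoint A B ∧ k ≤ A.ncard ∧ k ≤ B.ncard ∧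
    rk M A + rk M B ≤ rk M M.E + (k - 1)

/-- A matroid is 3-connected if it is connected and has no 2-separation. -/
def ThreeConnected (M : Matroid α) : Prop :=
  Connected M ∧ ∀ A B, ¬ Separation M 2 A B

/-- `M` is 3-connected up to series and parallel classes. -/
def ThreeConnUpToSP (M : Matroid α) : Prop :=
  Connected M ∧ ∀ A B, Separation M 2 A B →
    (SeriesClass M A ∨ ParallelClass M A ∨ SeriesClass M B ∨ ParallelClass M B)

/-- A 3-separating set of `M`. -/
def ThreeSeparating (M : Matroid α) (Y : Set α) : Prop :=
  Y ⊆ M.E ∧ rk M Y + rk M (M.E \ Y) ≤ rk M M.E + 2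

/-- `M` has path width 3: there is an ordering of the ground set all of whose initial
segments are 3-separating. -/
def PathWidth3 (M : Matroid α) : Prop :=
  ∃ (n : ℕ) (e : Fin n → α), Function.Injective e ∧ Set.range e = M.E ∧
    ∀ t : Fin n, ThreeSeparating M (e '' {i | i ≤ t})

/-- A segment: every 3-element subset is a triangle. -/
def Segment (M : Matroid α) (S : Set α) : Prop :=
  S ⊆ M.E ∧ ∀ T ⊆ S, T.ncard = 3 → Circuit M T

/-- A triangle: a 3-element circuit. -/
def Triangle (M : Matroid α) (S : Set α) : Prop := Circuit M S ∧ S.ncard = 3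

/-! ### Reduced representations `[I | C]` with `C = [[A, 1], [1ᵀ, w]]` -/

/-- The column, indexed by `x`, of the matrix `[I | C]` whose rows are indexed by
`(X \ {e}) ∪ {f}`, where `C` is the block matrix `[[A, 1], [1ᵀ, w]]` with row block `X \ {e}`,
column block `(E \ X) \ {f}`, last column `e`, last row `f`, and corner entry `w`. -/
noncomputable def colVec (X : Set α) (e f : α) (A : α → α → GF4) (w : GF4) :
    α → ((X \ {e} ∪ {f} : Set α) → GF4) := fun x r =>
  if x ∈ X \ {e} ∪ ({f} : Set α) then (if (r : α) = x then 1 else 0)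
  else if (r : α) = f then (if x = e then w else 1)
  else if x = e then 1 else A (r : α) x

/-- `M = M[I | C]` where `C` is the block matrix `[[A, 1], [1ᵀ, w]]` relative to the
basis `(X \ {e}) ∪ {f}`. -/
def RepBy (M : Matroid α) (X : Set α) (e f : α) (A : α → α → GF4) (w : GF4) : Prop :=
  ∀ I ⊆ M.E, (M.Indep I ↔
    LinearIndependent GF4 (fun x : I => colVec X e f A w (x : α)))

/-- The matrix `B`, with rows restricted to `R` and columns restricted to `K`, has an
`m × n` submatrix (up to permuting rows and columns) equal to the pattern `P`. -/
def HasPattern {m n : ℕ} (B : α → α → GF4) (R K : Set α) (P : Fin m → Fin n → GF4) : Prop :=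
  ∃ (r : Fin m → α) (c : Fin n → α), Function.Injective r ∧ Function.Injective c ∧
    (∀ i, r i ∈ R) ∧ (∀ j, c j ∈ K) ∧ ∀ i j, B (r i) (c j) = P i j

/-- One non-zero element of GF(4). -/
def NZ1 (x : GF4) : Prop := x ≠ 0

/-- Two distinct non-zero elements of GF(4). -/
def NZ2 (x y : GF4) : Prop := x ≠ 0 ∧ y ≠ 0 ∧ x ≠ y

/-- Three distinct non-zero elements of GF(4). -/
def NZ3 (x y z : GF4) : Prop :=
  x ≠ 0 ∧ y ≠ 0 ∧ z ≠ 0 ∧ x ≠ y ∧ x ≠ z ∧ y ≠ z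

/-- `B` (with rows from `R` and columns from `K`) contains one of the fifteen forbidden
submatrices, up to permuting rows and columns, where `x, y, z` denote distinct non-zero
elements of GF(4). -/
def HasForbidden (B : α → α → GF4) (R K : Set α) : Prop :=
  (∃ x y z, NZ3 x y z ∧ HasPattern B R K ![![x, y, z]]) ∨
  (∃ x y, NZ2 x y ∧ HasPattern B R K ![![x, y], ![0, x]]) ∨
  (∃ x y, NZ2 x y ∧ HasPattern B R K ![![x, y], ![y, x]]) ∨
  (∃ x y z, NZ3 x y z ∧ HasPattern B R K ![![x, y], ![z, x]]) ∨
  (∃ x y z, NZ3 x y z ∧ HasPattern B R K ![![x, x], ![y, z]]) ∨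
  (∃ x, NZ1 x ∧ HasPattern B R K ![![x, x, 0], ![x, 0, x]]) ∨
  (∃ x y, NZ2 x y ∧ HasPattern B R K ![![x, x, 0], ![x, 0, y]]) ∨
  (∃ x y, NZ2 x y ∧ HasPattern B R K ![![x, x, 0], ![y, 0, y]]) ∨
  (∃ x y, NZ2 x y ∧ HasPattern B R K ![![x, y, 0], ![x, 0, y]]) ∨
  (∃ x y z, NZ3 x y z ∧ HasPattern B R K ![![x, 0, 0], ![0, y, z]]) ∨
  (∃ x, NZ1 x ∧ HasPattern B R K ![![x, 0, 0], ![0, x, 0], ![0, 0, x]]) ∨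
  (∃ x y, NZ2 x y ∧ HasPattern B R K ![![x, 0, 0], ![0, x, 0], ![0, 0, y]]) ∨
  (∃ x y z, NZ3 x y z ∧ HasPattern B R K ![![x, 0, 0], ![0, y, 0], ![0, 0, z]]) ∨
  (∃ x y, NZ2 x y ∧ HasPattern B R K ![![x, y, x], ![y, y, 0], ![x, 0, 0]]) ∨
  (∃ x y z, NZ3 x y z ∧ HasPattern B R K ![![x, y, x], ![y, y, 0], ![x, 0, z]])

/-! ### The matroids `P₈⁻`, `F₇⁼` and its dual -/

/-- The columns of the GF(3)-matrix `[I₄ | A]` representing `P₈`, where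
`A = [[0,1,1,-1],[1,0,1,1],[1,1,0,1],[-1,1,1,0]]`. -/
def P8cols : Fin 8 → Fin 4 → ZMod 3 :=
  ![![1, 0, 0, 0], ![0, 1, 0, 0], ![0, 0, 1, 0], ![0, 0, 0, 1],
    ![0, 1, 1, -1], ![1, 0, 1, 1], ![1, 1, 0, 1], ![-1, 1, 1, 0]]

/-- `M` is isomorphic to `P₈`. -/
def IsP8 (M : Matroid α) : Prop :=
  ∃ g : α → Fin 8, Set.BijOn g M.E Set.univ ∧
    ∀ I ⊆ M.E, (M.Indep I ↔ LinearIndependent (ZMod 3) (fun x : I => P8cols (g (x : α))))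

/-- `M` is isomorphic to `P₈⁻`: it is obtained from a copy of `P₈` by relaxing one of its
pair of disjoint circuit-hyperplanes. -/
def IsP8Minus (M : Matroid α) : Prop :=
  ∃ (N : Matroid α) (X Y : Set α), IsP8 N ∧ CircuitHyperplane N Y ∧ Disjoint X Y ∧
    IsRelaxation N M X

/-- The columns of the rational matrix representing the non-Fano matroid `F₇⁻`: the seven
non-zero `{0,1}`-vectors of length 3. -/
def F7cols : Fin 7 → Fin 3 → ℚ :=
  ![![1, 0, 0], ![0, 1, 0], ![0, 0, 1], ![1, 1, 0], ![1, 0, 1], ![0, 1, 1], ![1, 1, 1]]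

/-- `M` is isomorphic to the non-Fano matroid `F₇⁻`. -/
def IsF7Minus (M : Matroid α) : Prop :=
  ∃ g : α → Fin 7, Set.BijOn g M.E Set.univ ∧
    ∀ I ⊆ M.E, (M.Indep I ↔ LinearIndependent ℚ (fun x : I => F7cols (g (x : α))))

/-- `M` is isomorphic to `F₇⁼`: it is obtained from a copy of `F₇⁻` by relaxing a
circuit-hyperplane. -/
def IsF7Eq (M : Matroid α) : Prop :=
  ∃ (N : Matroid α) (X : Set α), IsF7Minus N ∧ IsRelaxation N M X

end Relax

namespace Relax

/-- Exchanging the elements `r i` of the standard basis for the vectors `v (c j)` preserves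
independence exactly when the corresponding square submatrix is non-singular. -/
lemma linearIndependent_exchange_iff_det_ne_zero {α F : Type*} [Field F] {B : Set α}
    (hB : B.Finite) {v : α → B → F} (hv : ∀ x ∈ B, ∀ b : B, v x b = if (b : α) = x then 1 else 0)
    {k : ℕ} {r : Fin k → B} {c : Fin k → α}
    (hc : Function.Injective c) (hcB : ∀ j, c j ∉ B) :
    LinearIndependent F
        (fun x : (B \ range (fun i => (r i : α)) ∪ range c : Set α) => v (x : α)) ↔
      (Matrix.of fun i j => v (c j) (r i)).det ≠ 0 := by
  set S : Set α := B \ range (fun i => (r i : α)) with hS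
  have hdisj : Disjoint S (range c) := by
    rw [Set.disjoint_left]
    rintro x hx ⟨j, rfl⟩
    exact hcB j hx.1
  let E : S ⊕ Fin k ≃ (S ∪ range c : Set α) :=
    (Equiv.sumCongr (Equiv.refl S) (Equiv.ofInjective c hc)).trans (Equiv.Set.union hdisj).symm
  have hE : (fun x : (S ∪ range c : Set α) => v (x : α)) ∘ E =
      Sum.elim (fun s : S => v (s : α)) (fun j => v (c j)) := by
    funext x
    rcases x with x | x <;> simp [E]
  rw [← linearIndependent_equiv E, hE]
  have : Fintype S := (hB.subset sdiff_subset).fintype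
  rw [Fintype.linearIndependent_iff]
  have key : ∀ (g : S ⊕ Fin k → F) (b : B),
      (∑ i, g i • Sum.elim (fun s : S => v (s : α)) (fun j => v (c j)) i) b =
        (∑ s : S, if (b : α) = (s : α) then g (.inl s) else 0) +
          ∑ j, g (.inr j) * v (c j) b := by
    intro g b
    rw [Fintype.sum_sum_type]
    simp only [Sum.elim_inl, Sum.elim_inr, Pi.add_apply, Finset.sum_apply, Pi.smul_apply,
      smul_eq_mul]
    congr 1
    refine Finset.sum_congr rfl fun s _ => ?_
    rw [hv _ s.2.1]
    simp
  have hpivot : ∀ (g : S ⊕ Fin k → F) (i : Fin k),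
      (∑ s : S, if (r i : α) = (s : α) then g (.inl s) else 0) = 0 := fun g i =>
    Finset.sum_eq_zero fun s _ => if_neg fun h => s.2.2 ⟨i, h⟩
  have hrest : ∀ (g : S ⊕ Fin k → F) (s : S),
      (∑ t : S, if (s : α) = (t : α) then g (.inl t) else 0) = g (.inl s) := by
    intro g s
    simp only [Subtype.coe_inj]
    simp
  rw [Ne, ← Matrix.exists_mulVec_eq_zero_iff]
  constructor
  · rintro h ⟨u, hu0, hu⟩
    refine hu0 (funext fun j => ?_)
    let g : S ⊕ Fin k → F :=
      Sum.elim (fun s => -∑ j, u j * v (c j) ⟨s, s.2.1⟩) u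
    refine h g (funext fun b => ?_) (.inr j)
    rw [key]
    by_cases hb : (b : α) ∈ S
    · have := hrest g ⟨b, hb⟩
      simp only at this
      rw [this]
      simp [g]
    · obtain ⟨i, hi⟩ : ∃ i, r i = b := by
        by_contra! hcon
        exact hb ⟨b.2, fun ⟨i, hi⟩ => hcon i (Subtype.ext hi)⟩
      rw [← hi, hpivot]
      have := congrFun hu i
      simpa [Matrix.mulVec, dotProduct, g, mul_comm] using this
  · intro h g hg
    have hu : ∀ j, g (.inr j) = 0 := by
      by_contra! hne
      obtain ⟨j, hj⟩ := hne
      refine h ⟨fun j => g (.inr j), fun h0 => hj (congrFun h0 j), funext fun i => ?_⟩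
      have := congrFun hg (r i)
      rw [key, hpivot] at this
      simpa [Matrix.mulVec, dotProduct, mul_comm] using this
    rintro (s | j)
    · have := congrFun hg ⟨s, s.2.1⟩
      rw [key, hrest] at this
      simpa [hu] using this
    · exact hu j

/-- A relaxation has the same independent sets except for the relaxed set. -/
lemma IsRelaxation.indep_iff {α : Type*} {M M' : Matroid α} {X : Set α}
    (h : IsRelaxation M M' X) {I : Set α} (hI : I ≠ X) : M.Indep I ↔ M'.Indep I := by
  obtain ⟨⟨⟨-, hX⟩, -⟩, -, hbase⟩ := h
  constructor
  · intro hi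
    obtain ⟨B, hB, hIB⟩ := hi.exists_isBase_superset
    exact ((hbase B).2 (.inl hB)).indep.subset hIB
  · intro hi
    obtain ⟨B, hB, hIB⟩ := hi.exists_isBase_superset
    rcases (hbase B).1 hB with hB | rfl
    · exact hB.indep.subset hIB
    · exact hX I (hIB.ssubset_of_ne hI)

/-- The entries of the block matrix `[[A, 1], [1ᵀ, w]]` with last row `f` and last column `e`. -/
noncomputable def blockEntry {α : Type*} (e f : α) (A : α → α → GF4) (w : GF4) (r c : α) : GF4 :=
  if r = f then (if c = e then w else 1) else if c = e then 1 else A r c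

/-- The block matrices of a matroid and of its relaxation have the same non-zero minors, apart
from the entry in the corner. -/
lemma IsRelaxation.det_ne_zero_iff {α : Type*} {M M' : Matroid α} {X : Set α} {e f : α}
    {A A' : α → α → GF4} {w : GF4} (hfin : M.E.Finite) (hrel : IsRelaxation M M' X)
    (he : e ∈ X) (hf : f ∈ M.E \ X) (hA : RepBy M X e f A 0) (hA' : RepBy M' X e f A' w)
    {k : ℕ} {r c : Fin k → α} (hc : Function.Injective c)
    (hrB : ∀ i, r i ∈ X \ {e} ∪ {f}) (hcB : ∀ j, c j ∈ (M.E \ X) \ {f} ∪ {e})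
    (hce : ∃ j, c j ≠ e) :
    (Matrix.of fun i j => blockEntry e f A 0 (r i) (c j)).det ≠ 0 ↔
      (Matrix.of fun i j => blockEntry e f A' w (r i) (c j)).det ≠ 0 := by
  have hXE : X ⊆ M.E := hrel.1.1.1.subset_ground
  have hBE : X \ {e} ∪ {f} ⊆ M.E :=
    union_subset (sdiff_subset.trans hXE) (singleton_subset_iff.2 hf.1)
  have hc' : ∀ j, c j ∉ X \ {e} ∪ {f} := by
    intro j
    rcases hcB j with ⟨⟨-, h1⟩, h2⟩ | h
    · rintro (h3 | h3)
      exacts [h1 h3.1, h2 h3]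
    · rw [mem_singleton_iff] at h
      rw [h]
      rintro (h3 | h3)
      · exact h3.2 rfl
      · rw [mem_singleton_iff] at h3
        exact hf.2 (h3 ▸ he)
  have hentry : ∀ (D : α → α → GF4) (u : GF4) (i j : Fin k),
      colVec X e f D u (c j) ⟨r i, hrB i⟩ = blockEntry e f D u (r i) (c j) := by
    intro D u i j
    simp only [colVec, blockEntry, if_neg (hc' j)]
  have hdet : ∀ (D : α → α → GF4) (u : GF4), _ := fun D u =>
    linearIndependent_exchange_iff_det_ne_zero (hfin.subset hBE) (v := colVec X e f D u)
      (fun x hx b => by simp only [colVec, if_pos hx])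
      (r := fun i => ⟨r i, hrB i⟩) hc hc'
  simp only [hentry] at hdet
  rw [← hdet, ← hdet]
  have hIE : (X \ {e} ∪ {f}) \ range r ∪ range c ⊆ M.E := by
    refine union_subset (sdiff_subset.trans hBE) ?_
    rintro _ ⟨j, rfl⟩
    rcases hcB j with h | h
    · exact h.1.1
    · exact hXE (h ▸ he)
  have hne : (X \ {e} ∪ {f}) \ range r ∪ range c ≠ X := by
    obtain ⟨j, hj⟩ := hce
    intro h
    have hjX : c j ∈ X := h ▸ Or.inr ⟨j, rfl⟩
    rcases hcB j with h | h
    exacts [h.1.2 hjX, hj h]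
  exact ((hA _ hIE).symm.trans (hrel.indep_iff hne)).trans (hA' _ (hrel.2.1 ▸ hIE))

lemma GF4.sq_eq_add_one {w : GF4} (hw0 : w ≠ 0) (hw1 : w ≠ 1) : w ^ 2 = w + 1 := by
  have : Fintype GF4 := Fintype.ofFinite _
  have hcard : Fintype.card GF4 = 4 := by
    rw [← Nat.card_eq_fintype_card, GaloisField.card 2 2 (by norm_num)]
    norm_num
  have h4 : w ^ 4 = w := by
    rw [← hcard]
    exact FiniteField.pow_card w
  have h2 : (2 : GF4) = 0 := CharTwo.two_eq_zero
  have h : w * (w - 1) * (w ^ 2 - (w + 1)) = 0 := by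
    linear_combination h4 + (w - w ^ 3) * h2
  rcases mul_eq_zero.1 h with h | h
  · rcases mul_eq_zero.1 h with h | h
    · exact absurd h hw0
    · exact absurd (sub_eq_zero.1 h) hw1
  · exact sub_eq_zero.1 h

lemma GF4.eq_zero_or_one_or {w : GF4} (hw0 : w ≠ 0) (hw1 : w ≠ 1) (x : GF4) :
    x = 0 ∨ x = 1 ∨ x = w ∨ x = w + 1 := by
  by_cases hx0 : x = 0
  · exact .inl hx0
  by_cases hx1 : x = 1
  · exact .inr (.inl hx1)
  have h2 : (2 : GF4) = 0 := CharTwo.two_eq_zero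
  have h : (x - w) * (x - (w + 1)) = 0 := by
    linear_combination sq_eq_add_one hx0 hx1 + sq_eq_add_one hw0 hw1 + (w + 1 - w * x) * h2
  rcases mul_eq_zero.1 h with h | h
  · exact .inr (.inr (.inl (sub_eq_zero.1 h)))
  · exact .inr (.inr (.inr (sub_eq_zero.1 h)))

lemma GF4.mul_add_mul_add_mul_eq_zero {x y z : GF4} (h : NZ3 x y z) :
    x * y + x * z + y * z = 0 := by
  obtain ⟨hx, hy, hz, hxy, hxz, hyz⟩ := h
  have h1 : y / x ≠ 1 := fun h => hxy ((div_eq_one_iff_eq hx).1 h).symm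
  have h2 : (2 : GF4) = 0 := CharTwo.two_eq_zero
  have hz' := eq_zero_or_one_or (div_ne_zero hy hx) h1 (z / x)
  have hs := sq_eq_add_one (div_ne_zero hy hx) h1
  field_simp at hz' hs
  rcases hz' with h | h | h | h
  · exact absurd (by simpa using h) hz
  · exact absurd h.symm hxz
  · exact absurd h.symm hyz
  · rw [h]
    linear_combination hs + (x * y + x ^ 2 + y * x) * h2

/-- The relations, coming from minors of the bordered matrices, between the block `A` of a
matroid and the block `A'` of its relaxation. -/
structure BlocksAgree {α : Type*} (A A' : α → α → GF4) (w : GF4) (R K : Set α) : Prop where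
  eq_zero_iff : ∀ r ∈ R, ∀ c ∈ K, (A r c = 0 ↔ A' r c = 0)
  mul_ne_one : ∀ r ∈ R, ∀ c ∈ K, w * A' r c ≠ 1
  row_eq_iff : ∀ r ∈ R, ∀ c ∈ K, ∀ d ∈ K, c ≠ d → (A r c = A r d ↔ A' r c = A' r d)
  col_eq_iff : ∀ r ∈ R, ∀ s ∈ R, ∀ c ∈ K, (A r c = A s c ↔ A' r c = A' s c)
  diag_two_iff : ∀ r ∈ R, ∀ s ∈ R, ∀ c ∈ K, ∀ d ∈ K, c ≠ d → A r d = 0 → A s c = 0 →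
    (A r c + A s d = 0 ↔ A' r c + A' s d = w * A' r c * A' s d)
  diag_three_iff : ∀ r : Fin 3 → α, ∀ c : Fin 3 → α, (∀ i, r i ∈ R) → (∀ j, c j ∈ K) →
    Function.Injective c → (∀ i j, i ≠ j → A (r i) (c j) = 0) →
    (A (r 0) (c 0) * A (r 1) (c 1) + A (r 0) (c 0) * A (r 2) (c 2) +
        A (r 1) (c 1) * A (r 2) (c 2) = 0 ↔
      A' (r 0) (c 0) * A' (r 1) (c 1) + A' (r 0) (c 0) * A' (r 2) (c 2) +
        A' (r 1) (c 1) * A' (r 2) (c 2) =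
      w * A' (r 0) (c 0) * A' (r 1) (c 1) * A' (r 2) (c 2))

lemma IsRelaxation.blocksAgree {α : Type*} {M M' : Matroid α} {X : Set α} {e f : α}
    {A A' : α → α → GF4} {w : GF4} (hfin : M.E.Finite) (hrel : IsRelaxation M M' X)
    (he : e ∈ X) (hf : f ∈ M.E \ X) (hA : RepBy M X e f A 0) (hA' : RepBy M' X e f A' w) :
    BlocksAgree A A' w (X \ {e}) ((M.E \ X) \ {f}) := by
  have minor : ∀ {k : ℕ} (r c : Fin k → α), Function.Injective c →
      (∀ i, r i ∈ X \ {e} ∪ {f}) → (∀ j, c j ∈ (M.E \ X) \ {f} ∪ {e}) → (∃ j, c j ≠ e) →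
      ((Matrix.of fun i j => blockEntry e f A 0 (r i) (c j)).det = 0 ↔
        (Matrix.of fun i j => blockEntry e f A' w (r i) (c j)).det = 0) :=
    fun r c hc hrB hcB hce =>
      not_iff_not.1 (hrel.det_ne_zero_iff hfin he hf hA hA' hc hrB hcB hce)
  have hrf : ∀ {r}, r ∈ X \ {e} → r ≠ f := fun hr h => hf.2 (h ▸ hr.1)
  have hce : ∀ {c}, c ∈ (M.E \ X) \ {f} → c ≠ e := fun hc h => hc.1.2 (h ▸ he)
  have hzero : ∀ r ∈ X \ {e}, ∀ c ∈ (M.E \ X) \ {f}, (A r c = 0 ↔ A' r c = 0) := by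
    intro r hr c hc
    have := minor ![r] ![c] (Function.injective_of_subsingleton _)
      (by simpa using Or.inr hr) (by simpa using Or.inr hc) ⟨0, hce hc⟩
    simpa [blockEntry, hrf hr, hce hc] using this
  have hinj : ∀ {c d : α}, c ≠ d → Function.Injective ![c, d] := by
    intro c d hcd i j
    fin_cases i <;> fin_cases j <;> simp [hcd, hcd.symm]
  refine ⟨hzero, ?_, ?_, ?_, ?_, ?_⟩
  · intro r hr c hc
    have := minor ![r, f] ![c, e] (hinj (hce hc))
      (fun i => by fin_cases i; exacts [.inl hr, .inr rfl])
      (fun i => by fin_cases i; exacts [.inl hc, .inr rfl])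
      ⟨0, hce hc⟩
    simp [Matrix.det_fin_two, blockEntry, hrf hr, hce hc, sub_eq_zero] at this
    rwa [mul_comm]
  · intro r hr c hc d hd hcd
    have := minor ![r, f] ![c, d] (hinj hcd)
      (fun i => by fin_cases i; exacts [.inl hr, .inr rfl])
      (fun i => by fin_cases i; exacts [.inl hc, .inl hd])
      ⟨0, hce hc⟩
    simpa [Matrix.det_fin_two, blockEntry, hrf hr, hce hc, hce hd, sub_eq_zero] using this
  · intro r hr s hs c hc
    have := minor ![r, s] ![c, e] (hinj (hce hc))
      (fun i => by fin_cases i; exacts [.inl hr, .inl hs])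
     
      (fun i => by fin_cases i; exacts [.inl hc, .inr rfl])
      ⟨0, hce hc⟩
    simpa [Matrix.det_fin_two, blockEntry, hrf hr, hrf hs, hce hc, sub_eq_zero] using this
  · intro r hr s hs c hc d hd hcd h1 h2
    have hinj' : Function.Injective ![c, d, e] := by
      intro i j
      fin_cases i <;> fin_cases j <;>
        simp [hcd, hcd.symm, hce hc, hce hd, (hce hc).symm, (hce hd).symm]
    have := minor ![r, s, f] ![c, d, e] hinj'
      (fun i => by fin_cases i; exacts [.inl hr, .inl hs, .inr rfl])
      (fun i => by fin_cases i; exacts [.inl hc, .inl hd, .inr rfl])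
      ⟨0, hce hc⟩
    simp only [Matrix.det_fin_three, blockEntry, Matrix.of_apply, Matrix.cons_val, hrf hr, hrf hs,
      hce hc, hce hd, if_true, if_false, h1, h2, (hzero r hr d hd).1 h1,
      (hzero s hs c hc).1 h2] at this
    convert this using 1
    · rw [← neg_eq_zero]
      ring_nf
    · rw [← sub_eq_zero, ← neg_eq_zero]
      ring_nf
  · intro r c hr hc hcinj h0
    have h0' : ∀ i j, i ≠ j → A' (r i) (c j) = 0 := fun i j hij =>
      (hzero _ (hr i) _ (hc j)).1 (h0 i j hij)
    have hinj' : Function.Injective ![c 0, c 1, c 2, e] := by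
      have h01 : c 0 ≠ c 1 := hcinj.ne (by decide)
      have h02 : c 0 ≠ c 2 := hcinj.ne (by decide)
      have h12 : c 1 ≠ c 2 := hcinj.ne (by decide)
      have h := fun i => hce (hc i)
      have h' := fun i => (hce (hc i)).symm
      intro i j
      fin_cases i <;> fin_cases j <;> simp [h01, h02, h12, h01.symm, h02.symm, h12.symm, h, h']
    have := minor ![r 0, r 1, r 2, f] ![c 0, c 1, c 2, e] hinj'
      (fun i => by fin_cases i; exacts [.inl (hr 0), .inl (hr 1), .inl (hr 2), .inr rfl])
      (fun i => by fin_cases i; exacts [.inl (hc 0), .inl (hc 1), .inl (hc 2), .inr rfl])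
      ⟨0, hce (hc 0)⟩
    simp [Matrix.det_succ_row_zero, Fin.sum_univ_succ, blockEntry, hrf (hr _), hce (hc _), h0, h0',
      Fin.succAbove] at this
    convert this using 1
    · rw [← neg_eq_zero]
      ring_nf
    · rw [← sub_eq_zero, ← neg_eq_zero]
      ring_nf

namespace BlocksAgree

variable {α : Type*} {A A' : α → α → GF4} {w : GF4} {R K : Set α}

lemma eq_one_or_eq (h : BlocksAgree A A' w R K) (hw0 : w ≠ 0) (hw1 : w ≠ 1) {r c : α}
    (hr : r ∈ R) (hc : c ∈ K) (h0 : A r c ≠ 0) : A' r c = 1 ∨ A' r c = w := by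
  have h2 : (2 : GF4) = 0 := CharTwo.two_eq_zero
  rcases GF4.eq_zero_or_one_or hw0 hw1 (A' r c) with h1 | h1 | h1 | h1
  · exact absurd ((h.eq_zero_iff r hr c hc).2 h1) h0
  · exact .inl h1
  · exact .inr h1
  · refine absurd ?_ (h.mul_ne_one r hr c hc)
    rw [h1]
    linear_combination GF4.sq_eq_add_one hw0 hw1 + w * h2

lemma diag_two_eq_iff_ne (h : BlocksAgree A A' w R K) (hw0 : w ≠ 0) (hw1 : w ≠ 1) {r s c d : α}
    (hr : r ∈ R) (hs : s ∈ R) (hc : c ∈ K) (hd : d ∈ K) (hcd : c ≠ d)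
    (hrd : A r d = 0) (hsc : A s c = 0) (hrc : A r c ≠ 0) (hsd : A s d ≠ 0) :
    A r c = A s d ↔ A' r c ≠ A' s d := by
  have h2 : (2 : GF4) = 0 := CharTwo.two_eq_zero
  have hsq := GF4.sq_eq_add_one hw0 hw1
  rw [← CharTwo.add_eq_zero, h.diag_two_iff r hr s hs c hc d hd hcd hrd hsc]
  constructor
  · intro h1 h3
    refine h.mul_ne_one s hs d hd ?_
    have h4 : A' s d ≠ 0 := fun h4 => hsd ((h.eq_zero_iff s hs d hd).2 h4)
    rw [h3] at h1
    have h5 : A' s d * A' s d * w = 0 := by linear_combination A' s d * h2 - h1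
    exact absurd h5 (mul_ne_zero (mul_ne_zero h4 h4) hw0)
  · intro h1
    rcases h.eq_one_or_eq hw0 hw1 hr hc hrc with h3 | h3 <;>
      rcases h.eq_one_or_eq hw0 hw1 hs hd hsd with h4 | h4 <;> rw [h3, h4] at h1 ⊢
    · exact absurd rfl h1
    · linear_combination -hsq
    · linear_combination -hsq
    · exact absurd rfl h1

end BlocksAgree

lemma HasPattern.exists_two_by_three {α : Type*} {A : α → α → GF4} {R K : Set α}
    {x y z x' y' z' : GF4} (h : HasPattern A R K ![![x, y, z], ![x', y', z']]) :
    ∃ r ∈ R, ∃ s ∈ R, ∃ a ∈ K, ∃ b ∈ K, ∃ c ∈ K, a ≠ b ∧ a ≠ c ∧ b ≠ c ∧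
      A r a = x ∧ A r b = y ∧ A r c = z ∧ A s a = x' ∧ A s b = y' ∧ A s c = z' := by
  obtain ⟨r, c, -, hc, hr, hcK, hP⟩ := h
  exact ⟨r 0, hr 0, r 1, hr 1, c 0, hcK 0, c 1, hcK 1, c 2, hcK 2, hc.ne (by decide),
    hc.ne (by decide), hc.ne (by decide), hP 0 0, hP 0 1, hP 0 2, hP 1 0, hP 1 1, hP 1 2⟩

lemma HasPattern.exists_diag_three {α : Type*} {A : α → α → GF4} {R K : Set α} {x y z : GF4}
    (h : HasPattern A R K ![![x, 0, 0], ![0, y, 0], ![0, 0, z]]) :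
    ∃ r c : Fin 3 → α, Function.Injective c ∧ (∀ i, r i ∈ R) ∧ (∀ j, c j ∈ K) ∧
      (∀ i j, i ≠ j → A (r i) (c j) = 0) ∧
      A (r 0) (c 0) = x ∧ A (r 1) (c 1) = y ∧ A (r 2) (c 2) = z := by
  obtain ⟨r, c, -, hc, hr, hcK, hP⟩ := h
  refine ⟨r, c, hc, hr, hcK, fun i j hij => ?_, hP 0 0, hP 1 1, hP 2 2⟩
  rw [hP]
  fin_cases i <;> fin_cases j <;> simp at hij ⊢

namespace BlocksAgree

variable {α : Type*} {A A' : α → α → GF4} {w : GF4} {R K : Set α}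

/-- The four non-zero entries of the pattern correspond to entries of `A'` taking only two values,
which forces a parity condition on the equalities along the corresponding 4-cycle. -/
lemma not_hasPattern_two_by_three (h : BlocksAgree A A' w R K) (hw0 : w ≠ 0) (hw1 : w ≠ 1)
    {x y x' z' : GF4} (hx : x ≠ 0) (hy : y ≠ 0) (hx' : x' ≠ 0) (hz' : z' ≠ 0)
    (hparity : (x = y ↔ x = x') ↔ (x' = z' ↔ y = z')) :
    ¬ HasPattern A R K ![![x, y, 0], ![x', 0, z']] := by
  intro hP
  obtain ⟨r, hr, s, hs, a, ha, b, hb, c, hc, hab, hac, hbc, rfl, rfl, h3, rfl, h5, rfl⟩ :=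
    hP.exists_two_by_three
  have e1 := h.row_eq_iff r hr a ha b hb hab
  have e2 := h.row_eq_iff s hs a ha c hc hac
  have e3 := h.col_eq_iff r hr s hs a ha
  have e4 := h.diag_two_eq_iff_ne hw0 hw1 hr hs hb hc hbc h3 h5 hy hz'
  have v1 := h.eq_one_or_eq hw0 hw1 hr ha hx
  have v2 := h.eq_one_or_eq hw0 hw1 hr hb hy
  have v3 := h.eq_one_or_eq hw0 hw1 hs ha hx'
  have v4 := h.eq_one_or_eq hw0 hw1 hs hc hz'
  grind

/-- Along a diagonal `3 × 3` submatrix, equality of diagonal entries is reversed. -/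
lemma diag_three_eq_iff_ne (h : BlocksAgree A A' w R K) (hw0 : w ≠ 0) (hw1 : w ≠ 1)
    {r c : Fin 3 → α} (hc : Function.Injective c) (hr : ∀ i, r i ∈ R) (hcK : ∀ j, c j ∈ K)
    (hoff : ∀ i j, i ≠ j → A (r i) (c j) = 0) (hdiag : ∀ i, A (r i) (c i) ≠ 0) {i j : Fin 3}
    (hij : i ≠ j) : A (r i) (c i) = A (r j) (c j) ↔ A' (r i) (c i) ≠ A' (r j) (c j) :=
  h.diag_two_eq_iff_ne hw0 hw1 (hr i) (hr j) (hcK i) (hcK j) (hc.ne hij) (hoff i j hij)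
    (hoff j i hij.symm) (hdiag i) (hdiag j)

lemma not_hasPattern_diag_three (h : BlocksAgree A A' w R K) (hw0 : w ≠ 0) (hw1 : w ≠ 1)
    {x y z : GF4} (hxyz : NZ3 x y z) :
    ¬ HasPattern A R K ![![x, 0, 0], ![0, y, 0], ![0, 0, z]] := by
  intro hP
  obtain ⟨r, c, hc, hr, hcK, hoff, rfl, rfl, rfl⟩ := hP.exists_diag_three
  obtain ⟨h0, h1, h2, h01, h02, -⟩ := id hxyz
  have hdiag : ∀ i, A (r i) (c i) ≠ 0 := Fin.forall_fin_succ.2 ⟨h0, Fin.forall_fin_two.2 ⟨h1, h2⟩⟩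
  have e01 : A' (r 0) (c 0) = A' (r 1) (c 1) := by
    by_contra hne
    exact h01 ((h.diag_three_eq_iff_ne hw0 hw1 hc hr hcK hoff hdiag (by decide)).2 hne)
  have e02 : A' (r 0) (c 0) = A' (r 2) (c 2) := by
    by_contra hne
    exact h02 ((h.diag_three_eq_iff_ne hw0 hw1 hc hr hcK hoff hdiag (by decide)).2 hne)
  have e := (h.diag_three_iff r c hr hcK hc hoff).1 (GF4.mul_add_mul_add_mul_eq_zero hxyz)
  rw [← e01, ← e02] at e
  have hp : A' (r 0) (c 0) ≠ 0 := fun hp => h0 ((h.eq_zero_iff _ (hr 0) _ (hcK 0)).2 hp)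
  refine h.mul_ne_one _ (hr 0) _ (hcK 0) ?_
  have htwo : (2 : GF4) = 0 := CharTwo.two_eq_zero
  refine mul_right_cancel₀ (pow_ne_zero 2 hp) ?_
  linear_combination -e + A' (r 0) (c 0) ^ 2 * htwo

end BlocksAgree

end Relax

/-- With the setup as given, `A` has no submatrix of any of the forms
`[[x,x,0],[x,0,x]]`, `[[x,x,0],[x,0,y]]`, `[[x,x,0],[y,0,y]]`, `[[x,y,0],[x,0,y]]`,
`[[x,0,0],[0,y,z]]`, `diag(x,x,x)`, `diag(x,x,y)`, `diag(x,y,z)`, where `x, y, z` are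
distinct non-zero elements of GF(4). -/
theorem statement16 {α : Type*} (M M' : Matroid α) (X : Set α) (e f : α)
    (A A' : α → α → Relax.GF4) (w : Relax.GF4)
    (hfin : M.E.Finite)
    (hrel : Relax.IsRelaxation M M' X)
    (he : e ∈ X) (hf : f ∈ M.E \ X)
    (hB : M.IsBase (X \ {e} ∪ {f}))
    (hA : Relax.RepBy M X e f A 0)
    (hw0 : w ≠ 0) (hw1 : w ≠ 1)
    (hA' : Relax.RepBy M' X e f A' w) :
    (¬ ∃ x, Relax.NZ1 x ∧
      Relax.HasPattern A (X \ {e}) ((M.E \ X) \ {f}) ![![x, x, 0], ![x, 0, x]]) ∧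
    (¬ ∃ x y, Relax.NZ2 x y ∧
      Relax.HasPattern A (X \ {e}) ((M.E \ X) \ {f}) ![![x, x, 0], ![x, 0, y]]) ∧
    (¬ ∃ x y, Relax.NZ2 x y ∧
      Relax.HasPattern A (X \ {e}) ((M.E \ X) \ {f}) ![![x, x, 0], ![y, 0, y]]) ∧
    (¬ ∃ x y, Relax.NZ2 x y ∧
      Relax.HasPattern A (X \ {e}) ((M.E \ X) \ {f}) ![![x, y, 0], ![x, 0, y]]) ∧
    (¬ ∃ x y z, Relax.NZ3 x y z ∧
      Relax.HasPattern A (X \ {e}) ((M.E \ X) \ {f}) ![![x, 0, 0], ![0, y, z]]) ∧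
    (¬ ∃ x, Relax.NZ1 x ∧
      Relax.HasPattern A (X \ {e}) ((M.E \ X) \ {f})
        ![![x, 0, 0], ![0, x, 0], ![0, 0, x]]) ∧
    (¬ ∃ x y, Relax.NZ2 x y ∧
      Relax.HasPattern A (X \ {e}) ((M.E \ X) \ {f})
        ![![x, 0, 0], ![0, x, 0], ![0, 0, y]]) ∧
    (¬ ∃ x y z, Relax.NZ3 x y z ∧
      Relax.HasPattern A (X \ {e}) ((M.E \ X) \ {f})
        ![![x, 0, 0], ![0, y, 0], ![0, 0, z]]) := by
  have h := hrel.blocksAgree hfin he hf hA hA'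
  refine ⟨?_, ?_, ?_, ?_, ?_, ?_, ?_, ?_⟩
  · rintro ⟨x, hx, hP⟩
    exact h.not_hasPattern_two_by_three hw0 hw1 hx hx hx hx (by simp) hP
  · rintro ⟨x, y, ⟨hx, hy, hxy⟩, hP⟩
    exact h.not_hasPattern_two_by_three hw0 hw1 hx hx hx hy (by simp) hP
  · rintro ⟨x, y, ⟨hx, hy, hxy⟩, hP⟩
    exact h.not_hasPattern_two_by_three hw0 hw1 hx hx hy hy (by simp) hP
  · rintro ⟨x, y, ⟨hx, hy, hxy⟩, hP⟩
    exact h.not_hasPattern_two_by_three hw0 hw1 hx hy hx hy (by simp) hP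
  · rintro ⟨x, y, z, hxyz, hP⟩
    rw [Relax.NZ3] at hxyz
    obtain ⟨r, hr, s, hs, a, ha, b, hb, c, hc, hab, hac, hbc, h1, h2, h3, h4, h5, h6⟩ :=
      hP.exists_two_by_three
    have e1 := h.row_eq_iff s hs b hb c hc hbc
    have e2 := h.diag_two_eq_iff_ne hw0 hw1 hr hs ha hb hab h2 h4 (by grind) (by grind)
    have e3 := h.diag_two_eq_iff_ne hw0 hw1 hr hs ha hc hac h3 h4 (by grind) (by grind)
    grind
  · rintro ⟨x, hx, hP⟩
    rw [Relax.NZ1] at hx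
    obtain ⟨r, c, hc, hr, hcK, hoff, h0, h1, h2⟩ := hP.exists_diag_three
    have hdiag : ∀ i, A (r i) (c i) ≠ 0 := by simp [Fin.forall_fin_succ, *]
    have e01 := h.diag_three_eq_iff_ne hw0 hw1 hc hr hcK hoff hdiag (i := 0) (j := 1) (by decide)
    have e02 := h.diag_three_eq_iff_ne hw0 hw1 hc hr hcK hoff hdiag (i := 0) (j := 2) (by decide)
    have e12 := h.diag_three_eq_iff_ne hw0 hw1 hc hr hcK hoff hdiag (i := 1) (j := 2) (by decide)
    have v0 := h.eq_one_or_eq hw0 hw1 (hr 0) (hcK 0) (hdiag 0)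
    have v1 := h.eq_one_or_eq hw0 hw1 (hr 1) (hcK 1) (hdiag 1)
    have v2 := h.eq_one_or_eq hw0 hw1 (hr 2) (hcK 2) (hdiag 2)
    grind
  · rintro ⟨x, y, ⟨hx, hy, hxy⟩, hP⟩
    obtain ⟨r, c, hc, hr, hcK, hoff, h0, h1, h2⟩ := hP.exists_diag_three
    have hdiag : ∀ i, A (r i) (c i) ≠ 0 := by simp [Fin.forall_fin_succ, *]
    have e01 := h.diag_three_eq_iff_ne hw0 hw1 hc hr hcK hoff hdiag (i := 0) (j := 1) (by decide)
    have e02 := h.diag_three_eq_iff_ne hw0 hw1 hc hr hcK hoff hdiag (i := 0) (j := 2) (by decide)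
    have e12 := h.diag_three_eq_iff_ne hw0 hw1 hc hr hcK hoff hdiag (i := 1) (j := 2) (by decide)
    grind
  · rintro ⟨x, y, z, hxyz, hP⟩
    exact h.not_hasPattern_diag_three hw0 hw1 hxyz hP
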